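/- arXiv:1301.3029 — 4 statements merged into one kernel-verified Lean document; each statement's English description precedes it below -/
import Mathlib

section
/- Let n ≥ 3 be an integer, δ > 0 and ξ ∈ ℝⁿ. Then both ∫_{ℝⁿ} |∇U_{δ,ξ}(x)|² dx and ∫_{ℝⁿ} U_{δ,ξ}(x)^{2n/(n−2)} dx are finite and they are equal, where ∇U_{δ,ξ} is the Euclidean gradient. -/
open MeasureTheory

/-- The standard bubble `U_{δ,ξ}` on `ℝⁿ`. -/
noncomputable def bubble (n : ℕ) (δ : ℝ) (ξ x : EuclideanSpace ℝ (Fin n)) : ℝ :=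
  (Real.sqrt ((n : ℝ) * ((n : ℝ) - 2)) * δ / (δ ^ 2 + ‖x - ξ‖ ^ 2)) ^ (((n : ℝ) - 2) / 2)

theorem norm_gradient_eq_norm_fderiv {E : Type*} [NormedAddCommGroup E] [InnerProductSpace ℝ E]
    [CompleteSpace E] (f : E → ℝ) (x : E) : ‖gradient f x‖ = ‖fderiv ℝ f x‖ :=
  LinearIsometryEquiv.norm_map _ _

theorem integrable_inv_add_norm_sq_pow {E : Type*} [NormedAddCommGroup E] [NormedSpace ℝ E]
    [FiniteDimensional ℝ E] [MeasurableSpace E] [BorelSpace E] (μ : Measure E)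
    [μ.IsAddHaarMeasure] {a : ℝ} (ha : 0 < a) {k : ℕ} (hk : Module.finrank ℝ E < 2 * k) :
    Integrable (fun x : E => ((a + ‖x‖ ^ 2) ^ k)⁻¹) μ := by
  have h := integrable_rpow_neg_one_add_norm_sq (μ := μ) (E := E) (r := 2 * k) (by exact_mod_cast hk)
  have hm : 0 < min a 1 := lt_min ha one_pos
  refine (h.const_mul (((min a 1) ^ k)⁻¹)).mono' ?_ (.of_forall fun x => ?_)
  · exact Continuous.aestronglyMeasurable
      (Continuous.inv₀ (by fun_prop) fun x => by positivity)
  · have hx : (1 + ‖x‖ ^ 2 : ℝ) ^ (-(2 * (k : ℝ)) / 2) = ((1 + ‖x‖ ^ 2) ^ k)⁻¹ := by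
      rw [show -(2 * (k : ℝ)) / 2 = -(k : ℝ) by ring, Real.rpow_neg (by positivity),
        Real.rpow_natCast]
    rw [hx, Real.norm_of_nonneg (by positivity), ← mul_inv, ← mul_pow]
    gcongr
    nlinarith [min_le_left a 1, min_le_right a 1, sq_nonneg ‖x‖]

theorem tendsto_pow_div_add_sq_pow_atTop {a : ℝ} (ha : 0 < a) {m k : ℕ} (h : m < 2 * k) :
    Filter.Tendsto (fun r : ℝ => r ^ m / (a + r ^ 2) ^ k) Filter.atTop (nhds 0) := by
  have h0 : Filter.Tendsto (fun r : ℝ => r ^ m / r ^ (2 * k)) Filter.atTop (nhds 0) :=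
    tendsto_pow_div_pow_atTop_zero h
  refine squeeze_zero' ?_ ?_ h0
  · filter_upwards [Filter.eventually_gt_atTop 0] with r hr
    positivity
  · filter_upwards [Filter.eventually_gt_atTop 0] with r hr
    rw [pow_mul]
    gcongr
    linarith

theorem hasDerivAt_neg_pow_div_add_sq_pow {a : ℝ} (ha : 0 < a) (k : ℕ) (r : ℝ) :
    HasDerivAt (fun r : ℝ => -(r ^ (k + 1) / (a + r ^ 2) ^ k))
      (r ^ k * ((((k : ℝ) - 1) * r ^ 2 - (k + 1) * a) * ((a + r ^ 2) ^ (k + 1))⁻¹)) r := by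
  have hr : a + r ^ 2 ≠ 0 := by positivity
  have h := (((hasDerivAt_pow (k + 1) r).div
    (((hasDerivAt_pow 2 r).const_add a).pow k) (pow_ne_zero k hr))).neg
  refine h.congr_deriv ?_
  rcases k with _ | k
  · simp
    field_simp
    ring
  · simp only [Nat.add_sub_cancel, Pi.pow_apply]
    push_cast
    field_simp
    ring

theorem integrable_norm_sq_mul_inv_add_norm_sq_pow {E : Type*} [NormedAddCommGroup E]
    [NormedSpace ℝ E] [FiniteDimensional ℝ E] [MeasurableSpace E] [BorelSpace E] (μ : Measure E)
    [μ.IsAddHaarMeasure] {a : ℝ} (ha : 0 < a) {k : ℕ} (hk : Module.finrank ℝ E < 2 * k) :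
    Integrable (fun x : E => ‖x‖ ^ 2 * ((a + ‖x‖ ^ 2) ^ (k + 1))⁻¹) μ := by
  refine ((integrable_inv_add_norm_sq_pow μ ha hk).sub
    ((integrable_inv_add_norm_sq_pow μ ha (k := k + 1) (by omega)).const_mul a)).congr
    (.of_forall fun x => ?_)
  have hx : a + ‖x‖ ^ 2 ≠ 0 := by positivity
  simp only [Pi.sub_apply]
  field_simp
  ring

theorem integral_sub_mul_inv_add_norm_sq_pow_eq_zero {a : ℝ} (ha : 0 < a) {n : ℕ} (hn : 3 ≤ n) :
    ∫ x : EuclideanSpace ℝ (Fin n),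
      (((n : ℝ) - 2) * ‖x‖ ^ 2 - n * a) * ((a + ‖x‖ ^ 2) ^ n)⁻¹ = 0 := by
  obtain ⟨k, rfl⟩ : ∃ k, n = k + 1 := ⟨n - 1, by omega⟩
  have hint : Integrable (fun x : EuclideanSpace ℝ (Fin (k + 1)) =>
      (((k : ℝ) - 1) * ‖x‖ ^ 2 - (k + 1) * a) * ((a + ‖x‖ ^ 2) ^ (k + 1))⁻¹) := by
    refine (((integrable_norm_sq_mul_inv_add_norm_sq_pow volume ha (k := k)
      (by simp; omega)).const_mul ((k : ℝ) - 1)).sub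
      ((integrable_inv_add_norm_sq_pow volume ha (k := k + 1) (by simp)).const_mul
        ((k + 1) * a))).congr (.of_forall fun x => ?_)
    simp only [Pi.sub_apply]
    ring
  have hrad := (integrable_fun_norm_addHaar volume
    (f := fun r : ℝ => (((k : ℝ) - 1) * r ^ 2 - (k + 1) * a) * ((a + r ^ 2) ^ (k + 1))⁻¹)).1 hint
  have hzero := integral_Ioi_of_hasDerivAt_of_tendsto'
    (fun r _ => hasDerivAt_neg_pow_div_add_sq_pow ha k r)
    (by simpa using hrad)
    (tendsto_pow_div_add_sq_pow_atTop ha (m := k + 1) (k := k) (by omega)).neg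
  have h := integral_fun_norm_addHaar (volume : Measure (EuclideanSpace ℝ (Fin (k + 1))))
    (fun r : ℝ => (((k : ℝ) - 1) * r ^ 2 - (k + 1) * a) * ((a + r ^ 2) ^ (k + 1))⁻¹)
  simp only [finrank_euclideanSpace_fin, Nat.add_sub_cancel, smul_eq_mul, hzero] at h
  rw [show ((k + 1 : ℕ) : ℝ) - 2 = k - 1 by push_cast; ring, Nat.cast_succ, h]
  simp

theorem hasFDerivAt_bubble {n : ℕ} (hn : 3 ≤ n) {δ : ℝ} (hδ : 0 < δ)
    (ξ x : EuclideanSpace ℝ (Fin n)) :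
    HasFDerivAt (bubble n δ ξ)
      ((-((n : ℝ) - 2) * bubble n δ ξ x / (δ ^ 2 + ‖x - ξ‖ ^ 2)) • innerSL ℝ (x - ξ)) x := by
  have hn' : (3 : ℝ) ≤ n := by exact_mod_cast hn
  have hA : 0 < Real.sqrt ((n : ℝ) * ((n : ℝ) - 2)) * δ :=
    mul_pos (Real.sqrt_pos.2 (by nlinarith)) hδ
  have hD : 0 < δ ^ 2 + ‖x - ξ‖ ^ 2 := by positivity
  unfold bubble
  set A := Real.sqrt ((n : ℝ) * ((n : ℝ) - 2)) * δ
  have hsq : HasFDerivAt (fun y => δ ^ 2 + ‖y - ξ‖ ^ 2) (2 • innerSL ℝ (x - ξ)) x := by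
    simpa using (((hasFDerivAt_id x).sub_const ξ).norm_sq).const_add (δ ^ 2)
  have hdiv : HasDerivAt (fun t : ℝ => A / t) (-(A / (δ ^ 2 + ‖x - ξ‖ ^ 2) ^ 2))
      (δ ^ 2 + ‖x - ξ‖ ^ 2) := by
    simpa [div_eq_mul_inv] using (hasDerivAt_inv hD.ne').const_mul A
  have h := (hdiv.rpow_const (p := ((n : ℝ) - 2) / 2)
    (Or.inl (div_pos hA hD).ne')).comp_hasFDerivAt x hsq
  refine h.congr_fderiv ?_
  rw [Real.rpow_sub_one (div_pos hA hD).ne', ← Nat.cast_smul_eq_nsmul ℝ, smul_smul]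
  congr 1
  push_cast
  field_simp

theorem bubble_rpow_critical {n : ℕ} (hn : 3 ≤ n) {δ : ℝ} (hδ : 0 < δ)
    (ξ x : EuclideanSpace ℝ (Fin n)) :
    bubble n δ ξ x ^ (2 * (n : ℝ) / ((n : ℝ) - 2)) =
      (Real.sqrt ((n : ℝ) * ((n : ℝ) - 2)) * δ) ^ n * ((δ ^ 2 + ‖x - ξ‖ ^ 2) ^ n)⁻¹ := by
  have hn' : (n : ℝ) - 2 ≠ 0 := by
    have : (3 : ℝ) ≤ n := by exact_mod_cast hn
    linarith
  rw [bubble, ← Real.rpow_mul (by positivity),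
    show ((n : ℝ) - 2) / 2 * (2 * n / (n - 2)) = n by field_simp, Real.rpow_natCast, div_pow,
    div_eq_mul_inv]

theorem norm_gradient_bubble_sq {n : ℕ} (hn : 3 ≤ n) {δ : ℝ} (hδ : 0 < δ)
    (ξ x : EuclideanSpace ℝ (Fin n)) :
    ‖gradient (bubble n δ ξ) x‖ ^ 2 =
      (Real.sqrt ((n : ℝ) * ((n : ℝ) - 2)) * δ) ^ n * (((n : ℝ) - 2) / (n * δ ^ 2)) *
        (‖x - ξ‖ ^ 2 * ((δ ^ 2 + ‖x - ξ‖ ^ 2) ^ n)⁻¹) := by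
  have hn' : (0 : ℝ) < n - 2 := by
    have : (3 : ℝ) ≤ n := by exact_mod_cast hn
    linarith
  have hn₀ : (0 : ℝ) < n := by linarith
  have hD : 0 < δ ^ 2 + ‖x - ξ‖ ^ 2 := by positivity
  have hA : 0 < Real.sqrt ((n : ℝ) * ((n : ℝ) - 2)) * δ := by positivity
  have hA2 : (Real.sqrt ((n : ℝ) * ((n : ℝ) - 2)) * δ) ^ 2 = n * (n - 2) * δ ^ 2 := by
    rw [mul_pow, Real.sq_sqrt (by positivity)]
  have hU : bubble n δ ξ x ^ 2 = (Real.sqrt ((n : ℝ) * ((n : ℝ) - 2)) * δ) ^ n /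
      (n * (n - 2) * δ ^ 2) * ((δ ^ 2 + ‖x - ξ‖ ^ 2) ^ 2 * ((δ ^ 2 + ‖x - ξ‖ ^ 2) ^ n)⁻¹) := by
    rw [bubble, ← hA2, ← Real.rpow_mul_natCast (by positivity), Nat.cast_ofNat,
      div_mul_cancel₀ _ two_ne_zero, Real.rpow_sub (by positivity), Real.rpow_natCast,
      Real.rpow_two, div_pow, div_pow]
    field_simp
  rw [norm_gradient_eq_norm_fderiv, (hasFDerivAt_bubble hn hδ ξ x).fderiv, norm_smul,
    innerSL_apply_norm, mul_pow, Real.norm_eq_abs, sq_abs, div_pow, mul_pow, hU]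
  field_simp

theorem bubble_gradient_energy_eq_critical_mass
    (n : ℕ) (hn : 3 ≤ n) (δ : ℝ) (hδ : 0 < δ) (ξ : EuclideanSpace ℝ (Fin n)) :
    Integrable (fun x => ‖gradient (bubble n δ ξ) x‖ ^ 2) ∧
    Integrable (fun x => bubble n δ ξ x ^ (2 * (n : ℝ) / ((n : ℝ) - 2))) ∧
    ∫ x, ‖gradient (bubble n δ ξ) x‖ ^ 2 =
      ∫ x, bubble n δ ξ x ^ (2 * (n : ℝ) / ((n : ℝ) - 2)) := by
  have hn₀ : (n : ℝ) ≠ 0 := by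
    norm_cast
    omega
  simp only [norm_gradient_bubble_sq hn hδ, bubble_rpow_critical hn hδ]
  set C := (Real.sqrt ((n : ℝ) * ((n : ℝ) - 2)) * δ) ^ n
  have hδ2 : 0 < δ ^ 2 := by positivity
  have hgrad : Integrable (fun x : EuclideanSpace ℝ (Fin n) =>
      C * (((n : ℝ) - 2) / (n * δ ^ 2)) * (‖x - ξ‖ ^ 2 * ((δ ^ 2 + ‖x - ξ‖ ^ 2) ^ n)⁻¹)) := by
    have h := integrable_norm_sq_mul_inv_add_norm_sq_pow
      (volume : Measure (EuclideanSpace ℝ (Fin n))) hδ2 (k := n - 1) (by simp; omega)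
    rw [Nat.sub_add_cancel (by omega)] at h
    exact (h.comp_sub_right ξ).const_mul _
  have hmass : Integrable (fun x : EuclideanSpace ℝ (Fin n) =>
      C * ((δ ^ 2 + ‖x - ξ‖ ^ 2) ^ n)⁻¹) :=
    ((integrable_inv_add_norm_sq_pow volume hδ2 (by simp; omega)).comp_sub_right ξ).const_mul _
  refine ⟨hgrad, hmass, sub_eq_zero.1 ?_⟩
  rw [← integral_sub hgrad hmass]
  calc
    _ = ∫ x : EuclideanSpace ℝ (Fin n), C / (n * δ ^ 2) *
        ((((n : ℝ) - 2) * ‖x - ξ‖ ^ 2 - n * δ ^ 2) * ((δ ^ 2 + ‖x - ξ‖ ^ 2) ^ n)⁻¹) := by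
      congr with x
      field_simp
    _ = 0 := by
      rw [integral_const_mul, integral_sub_right_eq_self
        (fun x : EuclideanSpace ℝ (Fin n) =>
          (((n : ℝ) - 2) * ‖x‖ ^ 2 - n * δ ^ 2) * ((δ ^ 2 + ‖x‖ ^ 2) ^ n)⁻¹) ξ,
        integral_sub_mul_inv_add_norm_sq_pow_eq_zero hδ2 hn, mul_zero]
end

section
/- Let n ≥ 3 be an integer. There exists a constant C = C(n) > 0 such that for all δ₁, δ₂ > 0 and all ξ₁, ξ₂ ∈ ℝⁿ, the interaction integral satisfies ∫_{ℝⁿ} U_{δ₁,ξ₁}(x)^{(n+2)/(n−2)} U_{δ₂,ξ₂}(x) dx ≤ C · ( δ₁/δ₂ + δ₂/δ₁ + |ξ₁−ξ₂|²/(δ₁δ₂) )^{−(n−2)/2}. -/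
open MeasureTheory

/-- `|z|^(-2k)` cut off to the unit ball. -/
noncomputable def truncatedRiesz {E : Type*} [NormedAddCommGroup E] (k : ℝ) (z : E) : ℝ :=
  (Set.Iic (1 : ℝ)).indicator (fun r => r ^ (-(2 * k))) ‖z‖

lemma truncatedRiesz_nonneg {E : Type*} [NormedAddCommGroup E] (k : ℝ) (z : E) :
    0 ≤ truncatedRiesz k z := by
  unfold truncatedRiesz Set.indicator
  split_ifs
  · positivity
  · rfl

lemma integrable_truncatedRiesz (n : ℕ) (hn : 3 ≤ n) :
    Integrable (fun z : EuclideanSpace ℝ (Fin n) => truncatedRiesz (((n : ℝ) - 2) / 2) z) := by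
  have : Nonempty (Fin n) := ⟨⟨0, by omega⟩⟩
  unfold truncatedRiesz
  rw [integrable_fun_norm_addHaar (μ := volume) (E := EuclideanSpace ℝ (Fin n))
    (f := (Set.Iic (1 : ℝ)).indicator (fun r => r ^ (-(2 * (((n : ℝ) - 2) / 2)))))]
  have h : IntegrableOn ((Set.Iic (1 : ℝ)).indicator fun r : ℝ => r) (Set.Ioi 0) := by
    rw [IntegrableOn, integrable_indicator_iff measurableSet_Iic, IntegrableOn,
      Measure.restrict_restrict measurableSet_Iic, Set.inter_comm, Set.Ioi_inter_Iic]
    exact (continuous_id.integrableOn_Icc (a := (0 : ℝ)) (b := 1)).mono_set Set.Ioc_subset_Icc_self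
  refine h.congr_fun (fun r hr => ?_) measurableSet_Ioi
  have hr : 0 < r := hr
  by_cases h1 : r ≤ 1
  · rw [Set.indicator_of_mem (by exact h1), Set.indicator_of_mem (by exact h1),
      finrank_euclideanSpace, Fintype.card_fin, smul_eq_mul, ← Real.rpow_natCast, ← Real.rpow_add hr,
      Nat.cast_sub (by omega)]
    conv_lhs => rw [← Real.rpow_one r]
    congr 1
    push_cast
    ring
  · rw [Set.indicator_of_notMem (by exact h1), Set.indicator_of_notMem (by exact h1), smul_zero]

lemma integrable_one_add_norm_sq_rpow (n : ℕ) :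
    Integrable (fun z : EuclideanSpace ℝ (Fin n) =>
      (1 + ‖z‖ ^ 2) ^ (-(((n : ℝ) - 2) / 2 + 2))) := by
  have := integrable_rpow_neg_one_add_norm_sq (E := EuclideanSpace ℝ (Fin n)) (μ := volume)
    (r := (n : ℝ) + 2) (by simp)
  convert this using 3
  ring

lemma mul_rpow_neg_le_add {a b s t : ℝ} (ha : 0 < a) (hb : 0 < b) (hs : 0 ≤ s) (ht : 0 ≤ t) :
    a ^ (-s) * b ^ (-t) ≤ a ^ (-(t + s)) + b ^ (-(t + s)) := by
  rcases le_total a b with h | h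
  · calc a ^ (-s) * b ^ (-t) ≤ a ^ (-s) * a ^ (-t) := by
          gcongr ?_ * ?_
          exact Real.rpow_le_rpow_of_nonpos ha h (by linarith)
      _ = a ^ (-(t + s)) := by rw [← Real.rpow_add ha]; ring_nf
      _ ≤ _ := by have := Real.rpow_nonneg hb.le (-(t + s)); linarith
  · calc a ^ (-s) * b ^ (-t) ≤ b ^ (-s) * b ^ (-t) := by
          gcongr ?_ * ?_
          exact Real.rpow_le_rpow_of_nonpos hb h (by linarith)
      _ = b ^ (-(t + s)) := by rw [← Real.rpow_add hb]; ring_nf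
      _ ≤ _ := by have := Real.rpow_nonneg ha.le (-(t + s)); linarith

lemma rpow_add_le_two_rpow_mul {a b k : ℝ} (ha : 0 < a) (hb : 0 < b) (hk : 0 ≤ k) :
    (a + b) ^ k ≤ 2 ^ k * (a ^ k + b ^ k) := by
  rcases le_total a b with h | h
  · calc (a + b) ^ k ≤ (2 * b) ^ k := by gcongr; linarith
      _ = 2 ^ k * b ^ k := Real.mul_rpow (by norm_num) hb.le
      _ ≤ _ := by gcongr; have := Real.rpow_nonneg ha.le k; linarith
  · calc (a + b) ^ k ≤ (2 * a) ^ k := by gcongr; linarith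
      _ = 2 ^ k * a ^ k := Real.mul_rpow (by norm_num) ha.le
      _ ≤ _ := by gcongr; have := Real.rpow_nonneg hb.le k; linarith

section Pointwise

variable {E : Type*} [NormedAddCommGroup E]

lemma one_add_norm_sq_rpow_mul_norm_rpow_le {k : ℝ} (hk : 0 ≤ k) (y z : E) (hz : z ≠ 0) :
    (1 + ‖y‖ ^ 2) ^ (-2 : ℝ) * (‖z‖ ^ 2) ^ (-k) ≤
      truncatedRiesz k z +
        2 ^ k * ((1 + ‖y‖ ^ 2) ^ (-(k + 2)) + (1 + ‖z‖ ^ 2) ^ (-(k + 2))) := by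
  have hz0 : 0 < ‖z‖ := norm_pos_iff.mpr hz
  have hA : 0 < 1 + ‖y‖ ^ 2 := by positivity
  have hB : 0 < 1 + ‖z‖ ^ 2 := by positivity
  by_cases h1 : ‖z‖ ≤ 1
  · have e : truncatedRiesz k z = (‖z‖ ^ 2) ^ (-k) := by
      rw [truncatedRiesz, Set.indicator_of_mem (by exact h1), ← Real.rpow_natCast,
        ← Real.rpow_mul hz0.le]
      push_cast
      ring_nf
    rw [e]
    have : (1 + ‖y‖ ^ 2) ^ (-2 : ℝ) ≤ 1 :=
      Real.rpow_le_one_of_one_le_of_nonpos (by nlinarith [sq_nonneg ‖y‖]) (by norm_num)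
    have h2 : (1 + ‖y‖ ^ 2) ^ (-2 : ℝ) * (‖z‖ ^ 2) ^ (-k) ≤ 1 * (‖z‖ ^ 2) ^ (-k) := by gcongr
    have h3 : 0 ≤ 2 ^ k * ((1 + ‖y‖ ^ 2) ^ (-(k + 2)) + (1 + ‖z‖ ^ 2) ^ (-(k + 2))) := by
      positivity
    linarith
  · have h0 := truncatedRiesz_nonneg k z
    have h2 : (‖z‖ ^ 2) ^ (-k) ≤ 2 ^ k * (1 + ‖z‖ ^ 2) ^ (-k) := by
      calc (‖z‖ ^ 2) ^ (-k) ≤ ((1 + ‖z‖ ^ 2) / 2) ^ (-k) :=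
            Real.rpow_le_rpow_of_nonpos (by positivity) (by nlinarith) (by linarith)
        _ = _ := by
          rw [Real.div_rpow hB.le (by norm_num), Real.rpow_neg (by norm_num : (0 : ℝ) ≤ 2)]
          field_simp
    calc (1 + ‖y‖ ^ 2) ^ (-2 : ℝ) * (‖z‖ ^ 2) ^ (-k)
        ≤ (1 + ‖y‖ ^ 2) ^ (-2 : ℝ) * (2 ^ k * (1 + ‖z‖ ^ 2) ^ (-k)) := by gcongr
      _ = 2 ^ k * ((1 + ‖y‖ ^ 2) ^ (-2 : ℝ) * (1 + ‖z‖ ^ 2) ^ (-k)) := by ring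
      _ ≤ 2 ^ k * ((1 + ‖y‖ ^ 2) ^ (-(k + 2)) + (1 + ‖z‖ ^ 2) ^ (-(k + 2))) := by
        gcongr
        exact mul_rpow_neg_le_add hA hB (by norm_num) hk
      _ ≤ _ := by linarith

lemma rescaled_interaction_le {k ε : ℝ} (hk : 0 ≤ k) (y η : E) (h : y ≠ η) :
    (1 + ‖y‖ ^ 2) ^ (-(k + 2)) * (ε ^ 2 + ‖y - η‖ ^ 2) ^ (-k) ≤
      (1 + ε ^ 2 + ‖η‖ ^ 2) ^ (-k) * (4 ^ k * ((1 + ‖y‖ ^ 2) ^ (-(k + 2)) +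
        (truncatedRiesz k (y - η) +
          2 ^ k * ((1 + ‖y‖ ^ 2) ^ (-(k + 2)) + (1 + ‖y - η‖ ^ 2) ^ (-(k + 2)))))) := by
  have hz : y - η ≠ 0 := sub_ne_zero.mpr h
  have hz0 : 0 < ‖y - η‖ := norm_pos_iff.mpr hz
  have key := one_add_norm_sq_rpow_mul_norm_rpow_le hk y (y - η) hz
  set A := 1 + ‖y‖ ^ 2
  set B := ε ^ 2 + ‖y - η‖ ^ 2
  set D := 1 + ε ^ 2 + ‖η‖ ^ 2
  have A0 : 0 < A := by positivity
  have B0 : 0 < B := by positivity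
  have D0 : 0 < D := by positivity
  have hDAB : D ≤ 2 * (A + B) := by
    have := norm_sub_le y (y - η)
    rw [sub_sub_cancel] at this
    nlinarith [sq_nonneg (‖y‖ - ‖y - η‖), norm_nonneg η, norm_nonneg y, sq_nonneg ε]
  have hDk : D ^ k ≤ 4 ^ k * (A ^ k + B ^ k) := by
    calc D ^ k ≤ (2 * (A + B)) ^ k := by gcongr
      _ = 2 ^ k * (A + B) ^ k := Real.mul_rpow (by norm_num) (by positivity)
      _ ≤ 2 ^ k * (2 ^ k * (A ^ k + B ^ k)) := by
        gcongr; exact rpow_add_le_two_rpow_mul A0 B0 hk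
      _ = _ := by
        rw [← mul_assoc, ← Real.mul_rpow (by norm_num) (by norm_num)]; norm_num
  have hBz : B ^ (-k) ≤ (‖y - η‖ ^ 2) ^ (-k) :=
    Real.rpow_le_rpow_of_nonpos (by positivity) (by nlinarith [sq_nonneg ε]) (by linarith)
  have hAA : A ^ k * A ^ (-(k + 2)) = A ^ (-2 : ℝ) := by
    rw [← Real.rpow_add A0]; ring_nf
  have hBB : B ^ k * B ^ (-k) = 1 := by
    rw [← Real.rpow_add B0]; simp
  have hDD : D ^ (-k) * D ^ k = 1 := by
    rw [← Real.rpow_add D0]; simp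
  calc A ^ (-(k + 2)) * B ^ (-k)
      = D ^ (-k) * (D ^ k * (A ^ (-(k + 2)) * B ^ (-k))) := by rw [← mul_assoc, hDD, one_mul]
    _ ≤ D ^ (-k) * (4 ^ k * (A ^ k + B ^ k) * (A ^ (-(k + 2)) * B ^ (-k))) := by gcongr
    _ = D ^ (-k) * (4 ^ k * (A ^ (-(k + 2)) * (B ^ k * B ^ (-k)) +
          (A ^ k * A ^ (-(k + 2))) * B ^ (-k))) := by ring
    _ = D ^ (-k) * (4 ^ k * (A ^ (-(k + 2)) + A ^ (-2 : ℝ) * B ^ (-k))) := by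
        rw [hAA, hBB, mul_one]
    _ ≤ _ := by
        gcongr
        exact le_trans (by gcongr) key

end Pointwise

lemma exists_rescaled_interaction_bound (n : ℕ) (hn : 3 ≤ n) :
    ∃ C : ℝ, 0 < C ∧ ∀ (ε : ℝ) (η : EuclideanSpace ℝ (Fin n)),
      ∫ y : EuclideanSpace ℝ (Fin n), (1 + ‖y‖ ^ 2) ^ (-(((n : ℝ) - 2) / 2 + 2)) *
          (ε ^ 2 + ‖y - η‖ ^ 2) ^ (-(((n : ℝ) - 2) / 2)) ≤
        C * (1 + ε ^ 2 + ‖η‖ ^ 2) ^ (-(((n : ℝ) - 2) / 2)) := by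
  have : Nonempty (Fin n) := ⟨⟨0, by omega⟩⟩
  have hI := integrable_one_add_norm_sq_rpow n
  have hH := integrable_truncatedRiesz n hn
  have hk : 0 ≤ ((n : ℝ) - 2) / 2 := by
    have : (3 : ℝ) ≤ n := by exact_mod_cast hn
    linarith
  set k := ((n : ℝ) - 2) / 2
  set I := ∫ y : EuclideanSpace ℝ (Fin n), (1 + ‖y‖ ^ 2) ^ (-(k + 2))
  set H := ∫ y : EuclideanSpace ℝ (Fin n), truncatedRiesz k y
  have I0 : 0 ≤ I := integral_nonneg fun y => by positivity
  have H0 : 0 ≤ H := integral_nonneg fun y => truncatedRiesz_nonneg k y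
  refine ⟨4 ^ k * (I + (H + 2 ^ k * (I + I))) + 1, by positivity, fun ε η => ?_⟩
  have hI' := hI.comp_sub_right η
  have hH' := hH.comp_sub_right η
  have hII : Integrable (fun y : EuclideanSpace ℝ (Fin n) =>
      2 ^ k * ((1 + ‖y‖ ^ 2) ^ (-(k + 2)) + (1 + ‖y - η‖ ^ 2) ^ (-(k + 2)))) :=
    (hI.add hI').const_mul _
  have hsum : Integrable (fun y : EuclideanSpace ℝ (Fin n) => truncatedRiesz k (y - η) +
      2 ^ k * ((1 + ‖y‖ ^ 2) ^ (-(k + 2)) + (1 + ‖y - η‖ ^ 2) ^ (-(k + 2)))) := hH'.add hII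
  calc _ ≤ ∫ y : EuclideanSpace ℝ (Fin n), (1 + ε ^ 2 + ‖η‖ ^ 2) ^ (-k) *
        (4 ^ k * ((1 + ‖y‖ ^ 2) ^ (-(k + 2)) + (truncatedRiesz k (y - η) +
          2 ^ k * ((1 + ‖y‖ ^ 2) ^ (-(k + 2)) + (1 + ‖y - η‖ ^ 2) ^ (-(k + 2)))))) := by
        refine integral_mono_of_nonneg (Filter.Eventually.of_forall fun y => by positivity)
          (((hI.add hsum).const_mul _).const_mul _) ?_
        filter_upwards [compl_mem_ae_iff.mpr (measure_singleton η)] with y hy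
        exact rescaled_interaction_le hk y η hy
    _ = (4 ^ k * (I + (H + 2 ^ k * (I + I)))) * (1 + ε ^ 2 + ‖η‖ ^ 2) ^ (-k) := by
        rw [integral_const_mul, integral_const_mul, integral_add hI hsum, integral_add hH' hII,
          integral_const_mul, integral_add hI hI',
          integral_sub_right_eq_self (fun y => truncatedRiesz k y) η,
          integral_sub_right_eq_self
            (fun y : EuclideanSpace ℝ (Fin n) => (1 + ‖y‖ ^ 2) ^ (-(k + 2))) η]
        ring
    _ ≤ _ := by
        gcongr
        linarith

lemma bubble_rpow_mul_bubble_eq (n : ℕ) (hn : 3 ≤ n) {δ₁ δ₂ : ℝ} (h₁ : 0 < δ₁) (h₂ : 0 < δ₂)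
    (ξ₁ ξ₂ x : EuclideanSpace ℝ (Fin n)) :
    bubble n δ₁ ξ₁ x ^ (((n : ℝ) + 2) / ((n : ℝ) - 2)) * bubble n δ₂ ξ₂ x =
      Real.sqrt ((n : ℝ) * ((n : ℝ) - 2)) ^ n * (δ₂ / δ₁) ^ (((n : ℝ) - 2) / 2) * (δ₁ ^ n)⁻¹ *
        ((1 + ‖δ₁⁻¹ • (x - ξ₁)‖ ^ 2) ^ (-(((n : ℝ) - 2) / 2 + 2)) *
          ((δ₂ / δ₁) ^ 2 + ‖δ₁⁻¹ • (x - ξ₁) - δ₁⁻¹ • (ξ₂ - ξ₁)‖ ^ 2) ^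
            (-(((n : ℝ) - 2) / 2))) := by
  have hn' : (3 : ℝ) ≤ n := by exact_mod_cast hn
  have hc : 0 < Real.sqrt ((n : ℝ) * ((n : ℝ) - 2)) := Real.sqrt_pos.mpr (by nlinarith)
  unfold bubble
  set c := Real.sqrt ((n : ℝ) * ((n : ℝ) - 2))
  have e1 : c * δ₁ / (δ₁ ^ 2 + ‖x - ξ₁‖ ^ 2) =
      c * δ₁⁻¹ * (1 + ‖δ₁⁻¹ • (x - ξ₁)‖ ^ 2)⁻¹ := by
    rw [norm_smul, Real.norm_of_nonneg (by positivity)]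
    field_simp
  have e2 : c * δ₂ / (δ₂ ^ 2 + ‖x - ξ₂‖ ^ 2) =
      c * (δ₂ / δ₁) * δ₁⁻¹ *
        ((δ₂ / δ₁) ^ 2 + ‖δ₁⁻¹ • (x - ξ₁) - δ₁⁻¹ • (ξ₂ - ξ₁)‖ ^ 2)⁻¹ := by
    rw [← smul_sub, sub_sub_sub_cancel_right, norm_smul, Real.norm_of_nonneg (by positivity)]
    field_simp
  rw [e1, e2]
  set A := 1 + ‖δ₁⁻¹ • (x - ξ₁)‖ ^ 2
  set B := (δ₂ / δ₁) ^ 2 + ‖δ₁⁻¹ • (x - ξ₁) - δ₁⁻¹ • (ξ₂ - ξ₁)‖ ^ 2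
  have A0 : 0 < A := by positivity
  have B0 : 0 < B := by positivity
  have ek : ((n : ℝ) - 2) / 2 * (((n : ℝ) + 2) / ((n : ℝ) - 2)) = ((n : ℝ) - 2) / 2 + 2 := by
    have : (n : ℝ) - 2 ≠ 0 := by linarith
    field_simp
    ring
  have en : ∀ a : ℝ, 0 < a →
      a ^ n = a ^ (((n : ℝ) - 2) / 2 + 2) * a ^ (((n : ℝ) - 2) / 2) := fun a ha => by
    rw [← Real.rpow_add ha, ← Real.rpow_natCast]
    ring_nf
  rw [← Real.rpow_mul (by positivity), ek, en c hc, ← inv_pow, en δ₁⁻¹ (by positivity),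
    Real.rpow_neg A0.le, Real.rpow_neg B0.le, ← Real.inv_rpow A0.le, ← Real.inv_rpow B0.le]
  set k := ((n : ℝ) - 2) / 2
  rw [Real.mul_rpow (by positivity) (by positivity), Real.mul_rpow (by positivity) (by positivity),
    Real.mul_rpow (by positivity) (by positivity), Real.mul_rpow (by positivity) (by positivity),
    Real.mul_rpow (by positivity) (by positivity)]
  ring

theorem bubble_interaction_estimate (n : ℕ) (hn : 3 ≤ n) :
    ∃ C : ℝ, 0 < C ∧ ∀ δ₁ δ₂ : ℝ, 0 < δ₁ → 0 < δ₂ →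
      ∀ ξ₁ ξ₂ : EuclideanSpace ℝ (Fin n),
        ∫ x, bubble n δ₁ ξ₁ x ^ (((n : ℝ) + 2) / ((n : ℝ) - 2)) * bubble n δ₂ ξ₂ x ≤
          C * (δ₁ / δ₂ + δ₂ / δ₁ + ‖ξ₁ - ξ₂‖ ^ 2 / (δ₁ * δ₂)) ^ (-(((n : ℝ) - 2) / 2)) := by
  obtain ⟨C, hC, hbound⟩ := exists_rescaled_interaction_bound n hn
  have hn' : (3 : ℝ) ≤ n := by exact_mod_cast hn
  have hc : 0 < Real.sqrt ((n : ℝ) * ((n : ℝ) - 2)) := Real.sqrt_pos.mpr (by nlinarith)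
  refine ⟨Real.sqrt ((n : ℝ) * ((n : ℝ) - 2)) ^ n * C, by positivity,
    fun δ₁ δ₂ h₁ h₂ ξ₁ ξ₂ => ?_⟩
  simp_rw [bubble_rpow_mul_bubble_eq n hn h₁ h₂]
  set k := ((n : ℝ) - 2) / 2
  set c := Real.sqrt ((n : ℝ) * ((n : ℝ) - 2))
  set F : EuclideanSpace ℝ (Fin n) → ℝ := fun y => (1 + ‖y‖ ^ 2) ^ (-(k + 2)) *
    ((δ₂ / δ₁) ^ 2 + ‖y - δ₁⁻¹ • (ξ₂ - ξ₁)‖ ^ 2) ^ (-k)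
  have hscale : ∫ x, F (δ₁⁻¹ • (x - ξ₁)) = δ₁ ^ n * ∫ y, F y := by
    rw [integral_sub_right_eq_self (fun x => F (δ₁⁻¹ • x)) ξ₁,
      Measure.integral_comp_inv_smul_of_nonneg _ _ h₁.le, finrank_euclideanSpace,
      Fintype.card_fin, smul_eq_mul]
  have hS : δ₁ / δ₂ + δ₂ / δ₁ + ‖ξ₁ - ξ₂‖ ^ 2 / (δ₁ * δ₂) =
      (δ₂ / δ₁)⁻¹ * (1 + (δ₂ / δ₁) ^ 2 + ‖δ₁⁻¹ • (ξ₂ - ξ₁)‖ ^ 2) := by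
    rw [norm_smul, Real.norm_of_nonneg (by positivity), norm_sub_rev ξ₁ ξ₂]
    field_simp
  have hε : 0 < δ₂ / δ₁ := by positivity
  rw [integral_const_mul, hscale, hS, Real.mul_rpow (by positivity) (by positivity),
    Real.inv_rpow hε.le, ← Real.rpow_neg hε.le, neg_neg]
  calc c ^ n * (δ₂ / δ₁) ^ k * (δ₁ ^ n)⁻¹ * (δ₁ ^ n * ∫ y, F y)
      = c ^ n * (δ₂ / δ₁) ^ k * ∫ y, F y := by field_simp
    _ ≤ c ^ n * (δ₂ / δ₁) ^ k *
          (C * (1 + (δ₂ / δ₁) ^ 2 + ‖δ₁⁻¹ • (ξ₂ - ξ₁)‖ ^ 2) ^ (-k)) := by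
        gcongr
        exact hbound (δ₂ / δ₁) (δ₁⁻¹ • (ξ₂ - ξ₁))
    _ = _ := by ring
end

section
/- Let k ≥ 1 be an integer and p ≥ 1 a real number. There exists a constant C = C(k,p) > 0 such that for all nonnegative real numbers a₁, …, a_k one has 0 ≤ (a₁ + ⋯ + a_k)^p − (a₁^p + ⋯ + a_k^p) ≤ C · Σ_{i ≠ j} min(a_i, a_j) · max(a_i, a_j)^{p−1}. -/
open scoped BigOperators

/-- Superadditivity of `x ↦ x ^ p` on the nonnegative reals, for finite sums. -/
theorem sum_rpow_le_rpow_sum {ι : Type*} (s : Finset ι) {a : ι → ℝ} (ha : ∀ i ∈ s, 0 ≤ a i)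
    {p : ℝ} (hp : 1 ≤ p) : ∑ i ∈ s, a i ^ p ≤ (∑ i ∈ s, a i) ^ p := by
  have rpow_eq : ∀ x : ℝ, 0 ≤ x → x ^ p = x * x ^ (p - 1) := fun x hx => by
    rw [← Real.rpow_one_add' hx (by linarith), add_sub_cancel]
  rw [rpow_eq _ (Finset.sum_nonneg ha), Finset.sum_mul]
  refine Finset.sum_le_sum fun i hi => ?_
  rw [rpow_eq _ (ha i hi)]
  exact mul_le_mul_of_nonneg_left
    (Real.rpow_le_rpow (ha i hi) (Finset.single_le_sum ha hi) (by linarith)) (ha i hi)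

/-- The tangent line inequality for the convex function `x ↦ x ^ p` on the nonnegative reals. -/
theorem rpow_sub_rpow_le_mul_sub {x y p : ℝ} (hx : 0 ≤ x) (hxy : x ≤ y) (hp : 1 ≤ p) :
    y ^ p - x ^ p ≤ p * y ^ (p - 1) * (y - x) := by
  rcases (hx.trans hxy).eq_or_lt with rfl | hy
  · simp [le_antisymm hxy hx]
  have bernoulli := one_add_mul_self_le_rpow_one_add
    (s := x / y - 1) (by linarith [div_nonneg hx hy.le]) hp
  rw [add_sub_cancel, Real.div_rpow hx hy.le, le_div_iff₀ (Real.rpow_pos_of_pos hy p)] at bernoulli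
  have split : y ^ p = y * y ^ (p - 1) := by
    rw [← Real.rpow_one_add' hy.le (by linarith), add_sub_cancel]
  have expand : (1 + p * (x / y - 1)) * y ^ p = y ^ p - p * y ^ (p - 1) * (y - x) := by
    rw [split]
    field_simp
    ring
  linarith

theorem sum_rpow_expansion_estimate (k : ℕ) (hk : 1 ≤ k) (p : ℝ) (hp : 1 ≤ p) :
    ∃ C : ℝ, 0 < C ∧ ∀ a : Fin k → ℝ, (∀ i, 0 ≤ a i) →
      0 ≤ (∑ i, a i) ^ p - ∑ i, a i ^ p ∧
      (∑ i, a i) ^ p - ∑ i, a i ^ p ≤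
        C * ∑ i, ∑ j ∈ Finset.univ \ {i},
          min (a i) (a j) * max (a i) (a j) ^ (p - 1) := by
  have hk0 : (0 : ℝ) < k := by exact_mod_cast hk
  refine ⟨p * (k : ℝ) ^ (p - 1), by positivity, fun a ha =>
    ⟨sub_nonneg.2 (sum_rpow_le_rpow_sum _ (fun i _ => ha i) hp), ?_⟩⟩
  have : Nonempty (Fin k) := ⟨⟨0, hk⟩⟩
  obtain ⟨m, hm⟩ := Finite.exists_max a
  have sum_le : ∑ i, a i ≤ k * a m := by
    simpa using Finset.sum_le_card_nsmul Finset.univ a (a m) fun i _ => hm i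
  have le_sum : a m ≤ ∑ i, a i := Finset.single_le_sum (fun i _ => ha i) (Finset.mem_univ m)
  have rpow_le_sum : a m ^ p ≤ ∑ i, a i ^ p :=
    Finset.single_le_sum (f := fun i => a i ^ p)
      (fun i _ => Real.rpow_nonneg (ha i) p) (Finset.mem_univ m)
  have rest : ∑ i, a i - a m = ∑ j ∈ Finset.univ \ {m}, a j := by
    rw [← Finset.sum_sdiff (Finset.subset_univ {m}), Finset.sum_singleton, add_sub_cancel_right]
  calc (∑ i, a i) ^ p - ∑ i, a i ^ p
      ≤ (∑ i, a i) ^ p - a m ^ p := by linarith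
    _ ≤ p * (∑ i, a i) ^ (p - 1) * (∑ i, a i - a m) :=
        rpow_sub_rpow_le_mul_sub (ha m) le_sum hp
    _ ≤ p * (k * a m) ^ (p - 1) * (∑ i, a i - a m) := by
        refine mul_le_mul_of_nonneg_right (mul_le_mul_of_nonneg_left ?_ (by linarith))
          (sub_nonneg.2 le_sum)
        exact Real.rpow_le_rpow ((ha m).trans le_sum) sum_le (by linarith)
    _ = p * (k : ℝ) ^ (p - 1) * ∑ j ∈ Finset.univ \ {m},
          min (a m) (a j) * max (a m) (a j) ^ (p - 1) := by
        simp only [min_eq_right (hm _), max_eq_left (hm _), ← Finset.sum_mul]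
        rw [rest, Real.mul_rpow hk0.le (ha m)]
        ring
    _ ≤ _ := by
        refine mul_le_mul_of_nonneg_left ?_ (by positivity)
        exact Finset.single_le_sum (f := fun i => ∑ j ∈ Finset.univ \ {i},
            min (a i) (a j) * max (a i) (a j) ^ (p - 1))
          (fun i _ => Finset.sum_nonneg fun j _ => mul_nonneg (le_min (ha i) (ha j))
            (Real.rpow_nonneg (le_max_of_le_left (ha i)) _)) (Finset.mem_univ m)
end

section
/- Let n ≥ 5 be an integer, let H : ℝⁿ → ℝ be a bounded continuous function, let p ∈ ℝⁿ, t > 0, and let (δ_j), (μ_j) be sequences of positive reals with δ_j → 0, μ_j → 0 and δ_j/μ_j → 0 as j → ∞. Then (1/δ_j²) · ∫_{ℝⁿ} H(x/μ_j) · U_{t δ_j, μ_j p}(x)² dx → t² · H(p) · ∫_{ℝⁿ} U_{1,0}(y)² dy as j → ∞. -/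
open Filter Topology MeasureTheory

theorem bubble_sq_eq_pow {n : ℕ} (hn : 2 ≤ n) {δ : ℝ} (hδ : 0 ≤ δ)
    (ξ x : EuclideanSpace ℝ (Fin n)) :
    bubble n δ ξ x ^ 2 =
      (Real.sqrt ((n : ℝ) * ((n : ℝ) - 2)) * δ / (δ ^ 2 + ‖x - ξ‖ ^ 2)) ^ (n - 2) := by
  rw [bubble, ← Real.rpow_mul_natCast (by positivity), ← Real.rpow_natCast _ (n - 2)]
  congr 1
  push_cast [Nat.cast_sub hn]
  ring

theorem bubble_sq_smul_add {n : ℕ} (hn : 2 ≤ n) {δ : ℝ} (hδ : 0 < δ)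
    (ξ y : EuclideanSpace ℝ (Fin n)) :
    δ ^ n * bubble n δ ξ (δ • y + ξ) ^ 2 = δ ^ 2 * bubble n 1 0 y ^ 2 := by
  have hbase (c : ℝ) : c * δ / (δ ^ 2 + ‖δ • y + ξ - ξ‖ ^ 2) =
      δ⁻¹ * (c * 1 / (1 ^ 2 + ‖y - 0‖ ^ 2)) := by
    rw [add_sub_cancel_right, norm_smul, Real.norm_of_nonneg hδ.le, sub_zero]
    have : 1 + ‖y‖ ^ 2 ≠ 0 := by positivity
    have : δ ^ 2 + (δ * ‖y‖) ^ 2 ≠ 0 := by positivity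
    field_simp
  have hpow : δ ^ n = δ ^ 2 * δ ^ (n - 2) := by rw [← pow_add, Nat.add_sub_of_le hn]
  rw [bubble_sq_eq_pow hn hδ.le, bubble_sq_eq_pow hn zero_le_one, hbase, mul_pow, ← mul_assoc,
    inv_pow, hpow]
  field_simp

theorem integrable_bubble_one_sq {n : ℕ} (hn : 5 ≤ n) :
    Integrable fun y : EuclideanSpace ℝ (Fin n) => bubble n 1 0 y ^ 2 := by
  have hr : (Module.finrank ℝ (EuclideanSpace ℝ (Fin n)) : ℝ) < 2 * (n - 2) := by
    rw [finrank_euclideanSpace_fin]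
    have : (5 : ℝ) ≤ n := by exact_mod_cast hn
    linarith
  refine ((integrable_rpow_neg_one_add_norm_sq (μ := volume) hr).const_mul
    (Real.sqrt ((n : ℝ) * ((n : ℝ) - 2)) ^ (n - 2))).congr (Eventually.of_forall fun y => ?_)
  have hexp : -(2 * ((n : ℝ) - 2)) / 2 = -((n - 2 : ℕ) : ℝ) := by
    push_cast [Nat.cast_sub (show 2 ≤ n by omega)]
    ring
  simp only [hexp]
  rw [bubble_sq_eq_pow (by omega) zero_le_one, Real.rpow_neg (by positivity), Real.rpow_natCast,
    sub_zero, mul_one, one_pow, div_pow, div_eq_mul_inv]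

theorem integral_mul_bubble_sq {n : ℕ} (hn : 2 ≤ n) {δ : ℝ} (hδ : 0 < δ)
    (ξ : EuclideanSpace ℝ (Fin n)) (f : EuclideanSpace ℝ (Fin n) → ℝ) :
    ∫ x, f x * bubble n δ ξ x ^ 2 = δ ^ 2 * ∫ y, f (δ • y + ξ) * bubble n 1 0 y ^ 2 := by
  have hscale := Measure.integral_comp_smul_of_nonneg (volume : Measure (EuclideanSpace ℝ (Fin n)))
    (fun x => f (x + ξ) * bubble n δ ξ (x + ξ) ^ 2) δ (hR := hδ.le)
  rw [integral_add_right_eq_self (fun x => f x * bubble n δ ξ x ^ 2) ξ,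
    finrank_euclideanSpace_fin, smul_eq_mul, eq_inv_mul_iff_mul_eq₀ (by positivity)] at hscale
  rw [← hscale, ← integral_const_mul, ← integral_const_mul]
  refine integral_congr_ae (Eventually.of_forall fun y => ?_)
  linear_combination f (δ • y + ξ) * bubble_sq_smul_add hn hδ ξ y

theorem weighted_bubble_L2_mass_asymptotics
    (n : ℕ) (hn : 5 ≤ n)
    (H : EuclideanSpace ℝ (Fin n) → ℝ) (hHc : Continuous H)
    (hHb : ∃ M : ℝ, ∀ x, |H x| ≤ M)
    (p : EuclideanSpace ℝ (Fin n)) (t : ℝ) (ht : 0 < t)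
    (δ μ : ℕ → ℝ) (hδ : ∀ j, 0 < δ j) (hμ : ∀ j, 0 < μ j)
    (hδ0 : Tendsto δ atTop (𝓝 0)) (hμ0 : Tendsto μ atTop (𝓝 0))
    (hratio : Tendsto (fun j => δ j / μ j) atTop (𝓝 0)) :
    Tendsto
      (fun j => (1 / δ j ^ 2) *
        ∫ x, H ((μ j)⁻¹ • x) * bubble n (t * δ j) (μ j • p) x ^ 2)
      atTop (𝓝 (t ^ 2 * H p * ∫ y, bubble n 1 0 y ^ 2)) := by
  obtain ⟨M, hM⟩ := hHb
  have hlim : Tendsto (fun j => ∫ y, H ((t * (δ j / μ j)) • y + p) * bubble n 1 0 y ^ 2) atTop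
      (𝓝 (∫ y, H p * bubble n 1 0 y ^ 2)) := by
    have hint := integrable_bubble_one_sq hn
    refine tendsto_integral_of_dominated_convergence (fun y => M * bubble n 1 0 y ^ 2)
      (fun j => ?_) (hint.const_mul M) (fun j => Eventually.of_forall fun y => ?_)
      (Eventually.of_forall fun y => ?_)
    · exact (Continuous.aestronglyMeasurable (by fun_prop)).mul hint.aestronglyMeasurable
    · rw [norm_mul, Real.norm_of_nonneg (sq_nonneg (bubble n 1 0 y))]
      exact mul_le_mul_of_nonneg_right (hM _) (sq_nonneg _)
    · refine ((hHc.tendsto p).comp ?_).mul_const _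
      simpa using ((hratio.const_mul t).smul_const y).add_const p
  rw [integral_const_mul] at hlim
  rw [mul_assoc]
  refine (hlim.const_mul (t ^ 2)).congr fun j => ?_
  have hδj := (hδ j).ne'
  have harg (y : EuclideanSpace ℝ (Fin n)) :
      (μ j)⁻¹ • ((t * δ j) • y + μ j • p) = (t * (δ j / μ j)) • y + p := by
    rw [smul_add, inv_smul_smul₀ (hμ j).ne', smul_smul]
    congr 2
    ring
  rw [integral_mul_bubble_sq (by omega) (mul_pos ht (hδ j)) (μ j • p) fun x => H ((μ j)⁻¹ • x)]
  simp only [harg]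
  field_simp
end
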